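/- Let ϕ(z) = (2π)^{-1/2}·exp(−z²/2) denote the standard normal density, Φ(z) = ∫_{−∞}^{z} ϕ(t) dt the standard normal CDF, and define τ(z) = z·Φ(z) + ϕ(z). Let X be a set, f, m, σ : X → ℝ with σ(x) > 0 for all x, and β ≥ 0 such that |f(x) − m(x)| ≤ β·σ(x) for all x ∈ X. Let m⁻ ∈ ℝ satisfy m⁻ ≤ m(x) for all x ∈ X, define z(x) = (m⁻ − m(x))/σ(x), EI(x) = σ(x)·τ(z(x)), and I(x) = max(0, m⁻ − f(x)). Let x⋆ be a global minimizer of f (f(x⋆) ≤ f(x) for all x), let x₊ maximize EI over X (EI(x) ≤ EI(x₊) for all x), and suppose B > 0 satisfies B·I(x⋆) ≤ EI(x⋆), and D ≥ 0 satisfies m(x₊) − m⁻ ≤ D·σ(x₊). Then the instantaneous regret satisfies f(x₊) − f(x⋆) ≤ (D + β + 1/B)·σ(x₊). -/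

import Mathlib

open MeasureTheory

/-- Standard normal density. -/
noncomputable def stdNormalPDF (z : ℝ) : ℝ :=
  (Real.sqrt (2 * Real.pi))⁻¹ * Real.exp (-z ^ 2 / 2)

/-- Standard normal CDF. -/
noncomputable def stdNormalCDF (z : ℝ) : ℝ :=
  ∫ t in Set.Iic z, stdNormalPDF t

/-- The function τ(z) = z·Φ(z) + ϕ(z) from the Expected Improvement closed form. -/
noncomputable def tauEI (z : ℝ) : ℝ :=
  z * stdNormalCDF z + stdNormalPDF z

lemma stdNormalPDF_nonneg (z : ℝ) : 0 ≤ stdNormalPDF z := by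
  unfold stdNormalPDF
  positivity

lemma stdNormalPDF_le_one (z : ℝ) : stdNormalPDF z ≤ 1 := by
  unfold stdNormalPDF
  have hsqrt : (Real.sqrt (2 * Real.pi))⁻¹ ≤ 1 :=
    inv_le_one_of_one_le₀ (Real.one_le_sqrt.mpr (by linarith [Real.pi_gt_three]))
  have hexp : Real.exp (-z ^ 2 / 2) ≤ 1 :=
    Real.exp_le_one_iff.mpr (by linarith [sq_nonneg z])
  exact mul_le_one₀ hsqrt (Real.exp_pos _).le hexp

lemma stdNormalCDF_nonneg (z : ℝ) : 0 ≤ stdNormalCDF z :=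
  integral_nonneg stdNormalPDF_nonneg

lemma tauEI_le_one_of_nonpos {z : ℝ} (hz : z ≤ 0) : tauEI z ≤ 1 := by
  unfold tauEI
  linarith [mul_nonpos_of_nonpos_of_nonneg hz (stdNormalCDF_nonneg z), stdNormalPDF_le_one z]

/-- EI instantaneous regret bound (Lemma 1, EI part). -/
theorem ei_instantaneous_regret {X : Type*}
    (f m σ : X → ℝ) (hσ : ∀ x, 0 < σ x)
    (β : ℝ) (hβ : 0 ≤ β)
    (hconf : ∀ x, |f x - m x| ≤ β * σ x)
    (mminus : ℝ) (hm : ∀ x, mminus ≤ m x)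
    (xstar xplus : X)
    (hstar : ∀ x, f xstar ≤ f x)
    (hplus : ∀ x, σ x * tauEI ((mminus - m x) / σ x) ≤
      σ xplus * tauEI ((mminus - m xplus) / σ xplus))
    (B : ℝ) (hB : 0 < B)
    (hBI : B * max 0 (mminus - f xstar) ≤ σ xstar * tauEI ((mminus - m xstar) / σ xstar))
    (D : ℝ) (hD : 0 ≤ D)
    (hDb : m xplus - mminus ≤ D * σ xplus) :
    f xplus - f xstar ≤ (D + β + 1 / B) * σ xplus := by
  have htau : tauEI ((mminus - m xplus) / σ xplus) ≤ 1 :=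
    tauEI_le_one_of_nonpos
      (div_nonpos_of_nonpos_of_nonneg (sub_nonpos.mpr (hm xplus)) (hσ xplus).le)
  have hEI : B * max 0 (mminus - f xstar) ≤ σ xplus :=
    (hBI.trans (hplus xstar)).trans (mul_le_of_le_one_right (hσ xplus).le htau)
  have himprovement : mminus - f xstar ≤ 1 / B * σ xplus := by
    rw [one_div_mul_eq_div, le_div_iff₀' hB]
    exact (mul_le_mul_of_nonneg_left (le_max_right _ _) hB.le).trans hEI
  linarith [(abs_le.mp (hconf xplus)).2]
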